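/- arXiv:2509.17529 — 2 statements merged into one kernel-verified Lean document; each statement's English description precedes it below -/
import Mathlib

section
/- If f, g ∈ L¹(ℝⁿ), then the factorization identity ℋ(f ⋆_ℋ g)(y) = (ℋf)(y) · (ℋg)(y) holds for every y ∈ ℝⁿ. -/
open MeasureTheory Real Filter

noncomputable def Htransform (n : ℕ) (a b : ℝ) (f : (Fin n → ℝ) → ℝ)
    (y : Fin n → ℝ) : ℝ :=
  (2 * Real.pi) ^ (-(n : ℝ) / 2) *
    ∫ x, (a * Real.cos (∑ i, x i * y i) + b * Real.sin (∑ i, x i * y i)) * f x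

noncomputable def Kab (n : ℕ) (a b : ℝ) (f : (Fin n → ℝ) → ℝ) (x v : Fin n → ℝ) : ℝ :=
  (3 * a ^ 2 - b ^ 2) * f (x - v) +
    (a ^ 2 + b ^ 2) * (f (x + v) + f (-x + v) - f (-x - v))

noncomputable def Hconv (n : ℕ) (a b : ℝ) (f g : (Fin n → ℝ) → ℝ)
    (x : Fin n → ℝ) : ℝ :=
  (1 / (4 * a * (2 * Real.pi) ^ ((n : ℝ) / 2))) * ∫ v, Kab n a b f x v * g v

/-- The kernel `a cos (x · y) + b sin (x · y)` of the `ℋ`-transform. -/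
noncomputable def hKernel (n : ℕ) (a b : ℝ) (y x : Fin n → ℝ) : ℝ :=
  a * Real.cos (∑ i, x i * y i) + b * Real.sin (∑ i, x i * y i)

lemma continuous_hKernel (n : ℕ) (a b : ℝ) (y : Fin n → ℝ) :
    Continuous (hKernel n a b y) := by
  unfold hKernel
  fun_prop

lemma norm_hKernel_le (n : ℕ) (a b : ℝ) (y x : Fin n → ℝ) :
    ‖hKernel n a b y x‖ ≤ |a| + |b| := by
  unfold hKernel
  refine (norm_add_le _ _).trans (add_le_add ?_ ?_)
  · rw [norm_mul]
    exact mul_le_of_le_one_right (norm_nonneg _) (Real.abs_cos_le_one _)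
  · rw [norm_mul]
    exact mul_le_of_le_one_right (norm_nonneg _) (Real.abs_sin_le_one _)

lemma MeasureTheory.Integrable.hKernel_mul {n : ℕ} {f : (Fin n → ℝ) → ℝ}
    (hf : Integrable f volume) (a b : ℝ) (y : Fin n → ℝ) {k : (Fin n → ℝ) → (Fin n → ℝ)}
    (hk : Continuous k) : Integrable (fun x => hKernel n a b y (k x) * f x) volume :=
  hf.bdd_mul ((continuous_hKernel n a b y).comp hk).aestronglyMeasurable
    (.of_forall fun _ => norm_hKernel_le n a b y _)

/-- The product formula underlying the factorization identity. -/
lemma hKernel_product (n : ℕ) (a b : ℝ) (y x v : Fin n → ℝ) :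
    (3 * a ^ 2 - b ^ 2) * hKernel n a b y (x + v) +
      (a ^ 2 + b ^ 2) * (hKernel n a b y (x - v) + hKernel n a b y (v - x)
        - hKernel n a b y (-x - v)) =
    4 * a * hKernel n a b y v * hKernel n a b y x := by
  simp only [hKernel, Pi.add_apply, Pi.sub_apply, Pi.neg_apply, add_mul, sub_mul, neg_mul,
    Finset.sum_add_distrib, Finset.sum_sub_distrib, Finset.sum_neg_distrib,
    Real.cos_add, Real.cos_sub, Real.sin_add, Real.sin_sub, Real.cos_neg, Real.sin_neg]
  ring

lemma integral_mul_add_mul_add_sub {α : Type*} [MeasurableSpace α] {μ : Measure α} (c d : ℝ)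
    {f₁ f₂ f₃ f₄ : α → ℝ} (h₁ : Integrable f₁ μ) (h₂ : Integrable f₂ μ)
    (h₃ : Integrable f₃ μ) (h₄ : Integrable f₄ μ) :
    ∫ x, (c * f₁ x + d * (f₂ x + f₃ x - f₄ x)) ∂μ =
      c * ∫ x, f₁ x ∂μ + d * (∫ x, f₂ x ∂μ + ∫ x, f₃ x ∂μ - ∫ x, f₄ x ∂μ) := by
  have h₂₃ : Integrable (fun x => f₂ x + f₃ x) μ := h₂.add h₃
  have h₂₃₄ : Integrable (fun x => f₂ x + f₃ x - f₄ x) μ := h₂₃.sub h₄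
  rw [integral_add (h₁.const_mul c) (h₂₃₄.const_mul d), integral_const_mul, integral_const_mul,
    integral_sub h₂₃ h₄, integral_add h₂ h₃]

lemma integral_hKernel_mul_Kab {n : ℕ} (a b : ℝ) {f : (Fin n → ℝ) → ℝ}
    (hf : Integrable f volume) (y v : Fin n → ℝ) :
    ∫ x, hKernel n a b y x * Kab n a b f x v =
      4 * a * hKernel n a b y v * ∫ x, hKernel n a b y x * f x := by
  have i1 : Integrable (fun x => hKernel n a b y x * f (x - v)) volume :=
    (hf.comp_sub_right v).hKernel_mul a b y continuous_id
  have i2 : Integrable (fun x => hKernel n a b y x * f (x + v)) volume :=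
    (hf.comp_add_right v).hKernel_mul a b y continuous_id
  have i3 : Integrable (fun x => hKernel n a b y x * f (-x + v)) volume :=
    (hf.comp_add_right v).comp_neg.hKernel_mul a b y continuous_id
  have i4 : Integrable (fun x => hKernel n a b y x * f (-x - v)) volume :=
    (hf.comp_sub_right v).comp_neg.hKernel_mul a b y continuous_id
  have j1 := hf.hKernel_mul a b y (k := fun x => x + v) (by fun_prop)
  have j2 := hf.hKernel_mul a b y (k := fun x => x - v) (by fun_prop)
  have j3 := hf.hKernel_mul a b y (k := fun x => v - x) (by fun_prop)
  have j4 := hf.hKernel_mul a b y (k := fun x => -x - v) (by fun_prop)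
  have e1 : ∫ x, hKernel n a b y x * f (x - v) = ∫ x, hKernel n a b y (x + v) * f x := by
    rw [← integral_sub_right_eq_self (fun x => hKernel n a b y (x + v) * f x) v]
    simp
  have e2 : ∫ x, hKernel n a b y x * f (x + v) = ∫ x, hKernel n a b y (x - v) * f x := by
    rw [← integral_add_right_eq_self (fun x => hKernel n a b y (x - v) * f x) v]
    simp
  have e3 : ∫ x, hKernel n a b y x * f (-x + v) = ∫ x, hKernel n a b y (v - x) * f x := by
    rw [← integral_sub_left_eq_self (fun x => hKernel n a b y (v - x) * f x) volume v]
    simp [sub_eq_neg_add]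
  have e4 : ∫ x, hKernel n a b y x * f (-x - v) = ∫ x, hKernel n a b y (-x - v) * f x := by
    rw [← integral_sub_left_eq_self (fun x => hKernel n a b y (-x - v) * f x) volume (-v)]
    simp [sub_eq_add_neg, add_comm]
  calc ∫ x, hKernel n a b y x * Kab n a b f x v
      = ∫ x, ((3 * a ^ 2 - b ^ 2) * (hKernel n a b y x * f (x - v)) + (a ^ 2 + b ^ 2) *
          (hKernel n a b y x * f (x + v) + hKernel n a b y x * f (-x + v)
            - hKernel n a b y x * f (-x - v))) := by
        congr 1 with x
        unfold Kab
        ring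
    _ = ∫ x, ((3 * a ^ 2 - b ^ 2) * (hKernel n a b y (x + v) * f x) + (a ^ 2 + b ^ 2) *
          (hKernel n a b y (x - v) * f x + hKernel n a b y (v - x) * f x
            - hKernel n a b y (-x - v) * f x)) := by
        rw [integral_mul_add_mul_add_sub _ _ i1 i2 i3 i4,
          integral_mul_add_mul_add_sub _ _ j1 j2 j3 j4, e1, e2, e3, e4]
    _ = 4 * a * hKernel n a b y v * ∫ x, hKernel n a b y x * f x := by
        rw [← integral_const_mul]
        congr 1 with x
        linear_combination f x * hKernel_product n a b y x v

lemma integrable_comp_sub_mul {n : ℕ} {f g : (Fin n → ℝ) → ℝ}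
    (hf : Integrable f volume) (hg : Integrable g volume) :
    Integrable (fun p : (Fin n → ℝ) × (Fin n → ℝ) => f (p.1 - p.2) * g p.2)
      (volume.prod volume) := by
  simpa [mul_comm] using hg.convolution_integrand (ContinuousLinearMap.mul ℝ ℝ) hf

lemma integrable_comp_add_mul {n : ℕ} {f g : (Fin n → ℝ) → ℝ}
    (hf : Integrable f volume) (hg : Integrable g volume) :
    Integrable (fun p : (Fin n → ℝ) × (Fin n → ℝ) => f (p.1 + p.2) * g p.2)
      (volume.prod volume) := by
  have hm := (MeasurePreserving.id (volume : Measure (Fin n → ℝ))).prod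
    (Measure.measurePreserving_neg (volume : Measure (Fin n → ℝ)))
  simpa [Function.comp_def] using
    hm.integrable_comp_of_integrable (integrable_comp_sub_mul hf hg.comp_neg)

lemma integrable_Kab_mul {n : ℕ} (a b : ℝ) {f g : (Fin n → ℝ) → ℝ}
    (hf : Integrable f volume) (hg : Integrable g volume) :
    Integrable (fun p : (Fin n → ℝ) × (Fin n → ℝ) => Kab n a b f p.1 p.2 * g p.2)
      (volume.prod volume) := by
  have i3 := integrable_comp_sub_mul hf.comp_neg hg
  have i4 := integrable_comp_add_mul hf.comp_neg hg
  refine (((integrable_comp_sub_mul hf hg).const_mul (3 * a ^ 2 - b ^ 2)).add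
    ((((integrable_comp_add_mul hf hg).add i3).sub i4).const_mul (a ^ 2 + b ^ 2))).congr
    (.of_forall fun p => ?_)
  have h3 : -(p.1 - p.2) = -p.1 + p.2 := by abel
  have h4 : -(p.1 + p.2) = -p.1 - p.2 := by abel
  simp only [Kab, Pi.add_apply, Pi.sub_apply, h3, h4]
  ring

lemma integral_hKernel_mul_integral_Kab {n : ℕ} (a b : ℝ) {f g : (Fin n → ℝ) → ℝ}
    (hf : Integrable f volume) (hg : Integrable g volume) (y : Fin n → ℝ) :
    ∫ x, hKernel n a b y x * ∫ v, Kab n a b f x v * g v =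
      4 * a * (∫ x, hKernel n a b y x * f x) * ∫ v, hKernel n a b y v * g v := by
  have hi : Integrable (Function.uncurry fun x v : Fin n → ℝ =>
      hKernel n a b y x * (Kab n a b f x v * g v)) (volume.prod volume) :=
    (integrable_Kab_mul a b hf hg).bdd_mul
      ((continuous_hKernel n a b y).comp continuous_fst).aestronglyMeasurable
      (.of_forall fun _ => norm_hKernel_le n a b y _)
  have hx : ∀ x, hKernel n a b y x * ∫ v, Kab n a b f x v * g v =
      ∫ v, hKernel n a b y x * (Kab n a b f x v * g v) :=
    fun x => (integral_const_mul _ _).symm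
  simp_rw [hx]
  rw [integral_integral_swap hi, ← integral_const_mul]
  congr 1 with v
  simp_rw [← mul_assoc]
  rw [integral_mul_const, integral_hKernel_mul_Kab a b hf]
  ring

theorem stmt3 (n : ℕ) (hn : 1 ≤ n) (a b : ℝ) (ha : a ≠ 0)
    (hab : a ^ 2 + b ^ 2 ≠ 0) (hab1 : a ≠ b) (hab2 : a ≠ -b)
    (f g : (Fin n → ℝ) → ℝ) (hf : Integrable f volume) (hg : Integrable g volume) :
    ∀ y, Htransform n a b (Hconv n a b f g) y =
      Htransform n a b f y * Htransform n a b g y := by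
  intro y
  have hpos : (0 : ℝ) < (2 * Real.pi) ^ ((n : ℝ) / 2) := by positivity
  have hneg : (2 * Real.pi) ^ (-(n : ℝ) / 2) = ((2 * Real.pi) ^ ((n : ℝ) / 2))⁻¹ := by
    rw [neg_div, Real.rpow_neg (by positivity)]
  have key := integral_hKernel_mul_integral_Kab a b hf hg y
  have hH (φ : (Fin n → ℝ) → ℝ) : Htransform n a b φ y =
      ((2 * Real.pi) ^ ((n : ℝ) / 2))⁻¹ * ∫ x, hKernel n a b y x * φ x := by
    rw [Htransform, hneg]
    rfl
  rw [hH, hH, hH]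
  simp only [Hconv]
  simp_rw [mul_left_comm (hKernel n a b y _) (1 / _)]
  rw [integral_const_mul, key]
  field_simp
end

section
/- Wiener–Lévy criterion, positive form: let g ∈ L¹(ℝⁿ) and suppose 1 + (ℋg)(y) ≠ 0 for all y ∈ ℝⁿ. Then there exists η ∈ L¹(ℝⁿ) such that (ℋη)(y) = (ℋg)(y)/(1 + (ℋg)(y)) for every y ∈ ℝⁿ. -/
open MeasureTheory Real Filter

section ContinuousCharacter

variable {V : Type*} [NormedAddCommGroup V] [NormedSpace ℝ V]

/-- A continuous unitary character of a real normed space is the exponential of a linear form. -/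
theorem exists_dual_of_continuous_circle_hom (e : V → Circle) (he : Continuous e)
    (hadd : ∀ x y, e (x + y) = e x * e y) :
    ∃ l : V →L[ℝ] ℝ, ∀ x, e x = Circle.exp (l x) := by
  have he0 : e 0 = 1 := by simpa using hadd 0 0
  obtain ⟨θ, ⟨hθ0, hθ⟩, -⟩ := Circle.isCoveringMap_exp.existsUnique_continuousMap_lifts
    (⟨e, he⟩ : C(V, Circle)) 0 0 (by simp [he0])
  have hexp : ∀ x, Circle.exp (θ x) = e x := fun x => congrFun hθ x
  have hθadd : ∀ x y, θ (x + y) = θ x + θ y := by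
    intro x y
    refine congrFun (Circle.isCoveringMap_exp.eq_of_comp_eq
      (g₁ := fun x => θ (x + y)) (g₂ := fun x => θ x + θ y)
      (by fun_prop) (by fun_prop) ?_ 0 (by simp [hθ0])) x
    funext z
    simp [Circle.exp_add, hexp, hadd]
  exact ⟨(AddMonoidHom.mk' θ hθadd).toRealLinearMap θ.continuous, fun x => (hexp x).symm⟩

/-- A bounded continuous multiplicative character of a real normed space is unitary, hence given by
a linear form. -/
theorem exists_dual_of_bounded_hom (e : V → ℂ) (he : Continuous e) (he0 : e 0 = 1)
    (hadd : ∀ x y, e (x + y) = e x * e y) {C : ℝ} (hC : ∀ x, ‖e x‖ ≤ C) :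
    ∃ l : V →L[ℝ] ℝ, ∀ x, e x = Complex.exp (l x * Complex.I) := by
  have hpow : ∀ x (k : ℕ), e (k • x) = e x ^ k := by
    intro x k
    induction k with
    | zero => simp [he0]
    | succ k ih => rw [succ_nsmul, hadd, ih, pow_succ]
  have hle : ∀ x, ‖e x‖ ≤ 1 := by
    intro x
    by_contra! h
    obtain ⟨k, hk⟩ := pow_unbounded_of_one_lt C h
    exact absurd (hC (k • x)) (by rw [hpow, norm_pow]; exact not_le.mpr hk)
  have hone : ∀ x, ‖e x‖ = 1 := by
    intro x
    refine le_antisymm (hle x) ?_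
    have h : ‖e x‖ * ‖e (-x)‖ = 1 := by rw [← norm_mul, ← hadd]; simp [he0]
    nlinarith [hle x, hle (-x), norm_nonneg (e x), norm_nonneg (e (-x))]
  obtain ⟨l, hl⟩ := exists_dual_of_continuous_circle_hom
    (fun x => ⟨e x, mem_sphere_zero_iff_norm.mpr (hone x)⟩) (by fun_prop)
    (fun x y => Circle.ext (hadd x y))
  exact ⟨l, fun x => by simpa using congrArg Subtype.val (hl x)⟩

end ContinuousCharacter

section Convolution

set_option linter.unusedSectionVars false

variable {V : Type*} [NormedAddCommGroup V] [NormedSpace ℝ V] [FiniteDimensional ℝ V]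
  [MeasurableSpace V] [BorelSpace V] {μ : Measure V} [μ.IsAddHaarMeasure]

namespace L1Convolution

/-- Translation by `x` on `L¹`. -/
noncomputable def translate (x : V) : Lp ℂ 1 μ →L[ℂ] Lp ℂ 1 μ :=
  (Lp.compMeasurePreservingₗᵢ ℂ (fun z => -x + z)
    (measurePreserving_add_left μ (-x))).toContinuousLinearMap

theorem norm_translate (x : V) (f : Lp ℂ 1 μ) : ‖translate x f‖ = ‖f‖ :=
  LinearIsometry.norm_map _ f

theorem coeFn_translate (x : V) (f : Lp ℂ 1 μ) : translate x f =ᵐ[μ] fun z => f (-x + z) :=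
  Lp.coeFn_compMeasurePreserving f (measurePreserving_add_left μ (-x))

theorem translate_translate (x y : V) (f : Lp ℂ 1 μ) :
    translate x (translate y f) = translate (x + y) f := by
  apply Lp.ext
  have h := (measurePreserving_add_left μ (-x)).quasiMeasurePreserving.ae_eq_comp
    (coeFn_translate y f)
  filter_upwards [coeFn_translate x (translate y f), coeFn_translate (x + y) f, h]
    with z h1 h2 h3
  rw [h1, h2]
  simp only [Function.comp_apply] at h3
  rw [h3]
  congr 1
  abel

theorem translate_zero (f : Lp ℂ 1 μ) : translate 0 f = f := by
  apply Lp.ext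
  filter_upwards [coeFn_translate 0 f] with z h
  rw [h, neg_zero, zero_add]

theorem continuous_translate (f : Lp ℂ 1 μ) : Continuous fun x : V => translate x f := by
  let g : C(V, C(V, V)) := (ContinuousMap.mk (fun a : V × V => -a.1 + a.2) (by fun_prop)).curry
  exact (continuous_const (y := f)).compMeasurePreservingLp g.continuous
    (fun x => measurePreserving_add_left μ (-x)) (by simp)

theorem integrable_smul_translate {f : V → ℂ} (hf : Integrable f μ) (g : Lp ℂ 1 μ) :
    Integrable (fun x => f x • translate x g) μ := by
  refine Integrable.mono' (hf.norm.mul_const ‖g‖)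
    (hf.aestronglyMeasurable.smul (continuous_translate g).aestronglyMeasurable) ?_
  exact Eventually.of_forall fun x => by rw [norm_smul, norm_translate]

/-- Convolution on `L¹`, as a Bochner integral of translates. -/
noncomputable def conv (f g : Lp ℂ 1 μ) : Lp ℂ 1 μ := ∫ x, f x • translate x g ∂μ

theorem integrable_conv (f g : Lp ℂ 1 μ) : Integrable (fun x => f x • translate x g) μ :=
  integrable_smul_translate (L1.integrable_coeFn f) g

theorem conv_add (f g h : Lp ℂ 1 μ) : conv f (g + h) = conv f g + conv f h := by
  simp only [conv, map_add, smul_add]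
  exact integral_add (integrable_conv f g) (integrable_conv f h)

theorem conv_smul (c : ℂ) (f g : Lp ℂ 1 μ) : conv f (c • g) = c • conv f g := by
  simp only [conv, map_smul, smul_comm _ c]
  exact integral_smul c _

theorem add_conv (f g h : Lp ℂ 1 μ) : conv (f + g) h = conv f h + conv g h := by
  rw [conv, conv, conv, ← integral_add (integrable_conv f h) (integrable_conv g h)]
  refine integral_congr_ae ?_
  filter_upwards [Lp.coeFn_add f g] with x hx
  rw [hx, Pi.add_apply, add_smul]

theorem smul_conv (c : ℂ) (f g : Lp ℂ 1 μ) : conv (c • f) g = c • conv f g := by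
  rw [conv, conv, ← integral_smul]
  refine integral_congr_ae ?_
  filter_upwards [Lp.coeFn_smul c f] with x hx
  rw [hx, Pi.smul_apply, smul_eq_mul, mul_smul]

theorem norm_conv_le (f g : Lp ℂ 1 μ) : ‖conv f g‖ ≤ ‖f‖ * ‖g‖ := by
  refine (norm_integral_le_integral_norm _).trans_eq ?_
  simp only [norm_smul, norm_translate]
  rw [integral_mul_const, ← L1.norm_eq_integral_norm f]

/-- Convolution by `g` on the right, as a continuous linear map. -/
noncomputable def convRight (g : Lp ℂ 1 μ) : Lp ℂ 1 μ →L[ℂ] Lp ℂ 1 μ :=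
  LinearMap.mkContinuous
    { toFun := fun f => conv f g
      map_add' := fun f h => add_conv f h g
      map_smul' := fun c f => smul_conv c f g }
    ‖g‖ fun f => (norm_conv_le f g).trans_eq (mul_comm _ _)

theorem convRight_apply (f g : Lp ℂ 1 μ) : convRight g f = conv f g := rfl

theorem map_conv {F : Type*} [NormedAddCommGroup F] [NormedSpace ℂ F] [CompleteSpace F]
    (T : Lp ℂ 1 μ →L[ℂ] F) (f g : Lp ℂ 1 μ) :
    T (conv f g) = ∫ x, f x • T (translate x g) ∂μ := by
  rw [conv, ← T.integral_comp_comm (integrable_conv f g)]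
  simp only [map_smul]

theorem conv_translate (x : V) (f g : Lp ℂ 1 μ) :
    conv f (translate x g) = translate x (conv f g) := by
  rw [map_conv, conv]
  simp only [translate_translate, add_comm x]
  rfl

theorem translate_conv (x : V) (f g : Lp ℂ 1 μ) :
    conv (translate x f) g = translate x (conv f g) := by
  have h : conv (translate x f) g = ∫ z, f (-x + z) • translate z g ∂μ := by
    refine integral_congr_ae ?_
    filter_upwards [coeFn_translate x f] with z hz
    rw [hz]
  rw [h, map_conv, ← integral_add_left_eq_self _ x]
  simp only [translate_translate, neg_add_cancel_left]
  rfl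

theorem conv_assoc (f g h : Lp ℂ 1 μ) : conv (conv f g) h = conv f (conv g h) := by
  rw [← convRight_apply, map_conv]
  simp only [convRight_apply, translate_conv]
  rfl

/-- Pairing of `L¹` with a measurable function bounded by one. -/
noncomputable def pairing (φ : V → ℂ) (hφ : Measurable φ) (hb : ∀ x, ‖φ x‖ ≤ 1) :
    Lp ℂ 1 μ →L[ℂ] ℂ :=
  have h_int (f : Lp ℂ 1 μ) : Integrable (fun x => φ x * f x) μ :=
    (L1.integrable_coeFn f).bdd_mul hφ.aestronglyMeasurable (Eventually.of_forall hb)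
  LinearMap.mkContinuous
    { toFun := fun f => ∫ x, φ x * f x ∂μ
      map_add' := fun f g => by
        rw [← integral_add (h_int f) (h_int g)]
        refine integral_congr_ae ?_
        filter_upwards [Lp.coeFn_add f g] with x hx
        rw [hx, Pi.add_apply, mul_add]
      map_smul' := fun c f => by
        rw [RingHom.id_apply, ← integral_smul]
        refine integral_congr_ae ?_
        filter_upwards [Lp.coeFn_smul c f] with x hx
        rw [hx, Pi.smul_apply, smul_eq_mul, smul_eq_mul, mul_left_comm] }
    1 fun f => by
      rw [one_mul, L1.norm_eq_integral_norm]
      refine norm_integral_le_of_norm_le (L1.integrable_coeFn f).norm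
        (Eventually.of_forall fun x => ?_)
      rw [norm_mul]
      exact mul_le_of_le_one_left (norm_nonneg _) (hb x)

theorem pairing_apply (φ : V → ℂ) (hφ : Measurable φ) (hb : ∀ x, ‖φ x‖ ≤ 1) (f : Lp ℂ 1 μ) :
    pairing φ hφ hb f = ∫ x, φ x * f x ∂μ := rfl

theorem pairing_translate (φ : V → ℂ) (hφ : Measurable φ) (hb : ∀ x, ‖φ x‖ ≤ 1) (x : V)
    (f : Lp ℂ 1 μ) : pairing φ hφ hb (translate x f) = ∫ z, φ (x + z) * f z ∂μ := by
  have h : pairing φ hφ hb (translate x f) = ∫ z, φ z * f (-x + z) ∂μ := by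
    refine integral_congr_ae ?_
    filter_upwards [coeFn_translate x f] with z hz
    rw [hz]
  rw [h, ← integral_add_left_eq_self _ x]
  simp only [neg_add_cancel_left]

theorem conv_comm (f g : Lp ℂ 1 μ) : conv f g = conv g f := by
  have hpair : ∀ φ hφ hb, pairing φ hφ hb (conv f g) = pairing φ hφ hb (conv g f) := by
    intro φ hφ hb
    simp only [map_conv, pairing_translate, smul_eq_mul, ← integral_const_mul]
    rw [integral_integral_swap]
    · refine integral_congr_ae (Eventually.of_forall fun x => integral_congr_ae
        (Eventually.of_forall fun z => ?_))
      simp only [add_comm z x]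
      ring
    · have h := ((L1.integrable_coeFn f).mul_prod (L1.integrable_coeFn g)).bdd_mul (c := 1)
        (f := fun p : V × V => φ (p.1 + p.2))
        (hφ.comp measurable_add).aestronglyMeasurable (Eventually.of_forall fun p => hb _)
      refine h.congr (Eventually.of_forall fun p => ?_)
      simp only [Function.uncurry]
      ring
  refine Lp.ext (Integrable.ae_eq_of_forall_setIntegral_eq _ _ (L1.integrable_coeFn _)
    (L1.integrable_coeFn _) fun s hs _ => ?_)
  have h := hpair (s.indicator 1) (measurable_one.indicator hs)
    (fun x => by by_cases hx : x ∈ s <;> simp [hx])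
  simpa only [pairing_apply, ← Set.indicator_mul_left, Pi.one_apply, one_mul,
    integral_indicator hs] using h

/-- The Fourier functional on `L¹` at the frequency `l`. -/
noncomputable def fourier (l : V →L[ℝ] ℝ) : Lp ℂ 1 μ →L[ℂ] ℂ :=
  pairing (fun x => Complex.exp (l x * Complex.I)) (by fun_prop)
    fun x => (Complex.norm_exp_ofReal_mul_I _).le

theorem fourier_apply (l : V →L[ℝ] ℝ) (f : Lp ℂ 1 μ) :
    fourier l f = ∫ x, Complex.exp (l x * Complex.I) * f x ∂μ := rfl

theorem fourier_conv (l : V →L[ℝ] ℝ) (f g : Lp ℂ 1 μ) :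
    fourier l (conv f g) = fourier l f * fourier l g := by
  rw [map_conv, fourier_apply l f, ← integral_mul_const]
  refine integral_congr_ae (Eventually.of_forall fun x => ?_)
  beta_reduce
  rw [fourier, pairing_translate]
  simp only [map_add, Complex.ofReal_add, add_mul, Complex.exp_add, mul_assoc, integral_const_mul,
    pairing_apply, smul_eq_mul]
  ring

/-- A nonzero multiplicative continuous functional on `L¹` is a Fourier functional. -/
theorem exists_eq_fourier (χ : Lp ℂ 1 μ →L[ℂ] ℂ)
    (hχ : ∀ f g, χ (conv f g) = χ f * χ g) (hne : χ ≠ 0) :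
    ∃ l : V →L[ℝ] ℝ, χ = fourier l := by
  obtain ⟨f, hf⟩ : ∃ f, χ f ≠ 0 := by
    by_contra! h
    exact hne (ContinuousLinearMap.ext h)
  have hmul : ∀ x g, χ (translate x g) * χ f = χ (translate x f) * χ g := by
    intro x g
    rw [← hχ, ← hχ, translate_conv, translate_conv, conv_comm]
  obtain ⟨l, hl⟩ := exists_dual_of_bounded_hom (fun x => χ (translate x f) / χ f)
    ((χ.continuous.comp (continuous_translate f)).div_const _)
    (by simp only [translate_zero]; exact div_self hf)
    (fun x y => by
      have h := hmul x (translate y f)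
      rw [translate_translate] at h
      field_simp
      linear_combination h)
    (C := ‖χ‖ * ‖f‖ / ‖χ f‖)
    (fun x => by
      rw [norm_div]
      gcongr
      exact (χ.le_opNorm _).trans_eq (by rw [norm_translate]))
  refine ⟨l, ContinuousLinearMap.ext fun g => ?_⟩
  have h : χ g * χ f = fourier l g * χ f := by
    rw [← hχ, map_conv, fourier_apply, ← integral_mul_const]
    refine integral_congr_ae (Eventually.of_forall fun x => ?_)
    simp only [← hl, smul_eq_mul]
    field_simp
  exact mul_right_cancel₀ hf h

/-- The space `L¹` with convolution as multiplication. -/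
def ConvAlgebra (μ : Measure V) : Type _ := Lp ℂ 1 μ

namespace ConvAlgebra

noncomputable instance : NormedAddCommGroup (ConvAlgebra μ) :=
  inferInstanceAs (NormedAddCommGroup (Lp ℂ 1 μ))

noncomputable instance : NormedSpace ℂ (ConvAlgebra μ) :=
  inferInstanceAs (NormedSpace ℂ (Lp ℂ 1 μ))

instance : CompleteSpace (ConvAlgebra μ) :=
  inferInstanceAs (CompleteSpace (Lp ℂ 1 μ))

noncomputable instance : Mul (ConvAlgebra μ) := ⟨fun f g => conv (μ := μ) f g⟩

noncomputable instance : NonUnitalNormedCommRing (ConvAlgebra μ) where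
  __ := (inferInstance : NormedAddCommGroup (ConvAlgebra μ))
  mul := (· * ·)
  left_distrib := conv_add
  right_distrib := add_conv
  zero_mul f := (convRight (μ := μ) f).map_zero
  mul_zero f := (conv_comm (μ := μ) f 0).trans (convRight (μ := μ) f).map_zero
  mul_assoc := conv_assoc
  mul_comm := conv_comm
  norm_mul_le := norm_conv_le

instance : IsScalarTower ℂ (ConvAlgebra μ) (ConvAlgebra μ) :=
  ⟨fun c f g => smul_conv (μ := μ) c f g⟩

instance : SMulCommClass ℂ (ConvAlgebra μ) (ConvAlgebra μ) :=
  ⟨fun c f g => (conv_smul (μ := μ) c f g).symm⟩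

/-- The `L¹` unitization of the convolution algebra. -/
abbrev Unital (μ : Measure V) [μ.IsAddHaarMeasure] : Type _ :=
  WithLp 1 (Unitization ℂ (ConvAlgebra μ))

noncomputable instance : NormedCommRing (Unital μ) where
  __ := WithLp.instUnitizationNormedRing
  mul_comm x y := (WithLp.equiv 1 (Unitization ℂ (ConvAlgebra μ))).injective
    (mul_comm (WithLp.ofLp x) (WithLp.ofLp y))

noncomputable instance : NormedAlgebra ℂ (Unital μ) where
  __ := (WithLp.instUnitizationNormedAlgebra : NormedAlgebra ℂ (Unital μ))

/-- The inclusion of `L¹` in its unitization. -/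
noncomputable def incl : Lp ℂ 1 μ →L[ℂ] Unital μ :=
  LinearMap.mkContinuous
    ((WithLp.linearEquiv 1 ℂ (Unitization ℂ (ConvAlgebra μ))).symm.toLinearMap ∘ₗ
      Unitization.inrHom ℂ ℂ (ConvAlgebra μ))
    1 fun f => by
      rw [one_mul]
      exact (WithLp.unitization_norm_inr (𝕜 := ℂ) (A := ConvAlgebra μ) f).le

theorem incl_conv (f g : Lp ℂ 1 μ) : incl (conv f g) = incl f * incl g :=
  (WithLp.equiv 1 (Unitization ℂ (ConvAlgebra μ))).injective
    (Unitization.inr_mul ℂ (A := ConvAlgebra μ) f g)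

end ConvAlgebra

open ConvAlgebra in
/-- **Wiener's lemma** in `L¹`: an element `1 + f` of the unitized convolution algebra whose Fourier
transform does not vanish has an inverse `1 - h`. -/
theorem exists_quasi_inverse (f : Lp ℂ 1 μ) (hf : ∀ l : V →L[ℝ] ℝ, 1 + fourier l f ≠ 0) :
    ∃ h : Lp ℂ 1 μ, f = h + conv f h := by
  have hunit : IsUnit (1 + incl f) := by
    by_contra hu
    obtain ⟨χ, hχ⟩ := WeakDual.CharacterSpace.exists_apply_eq_zero hu
    rw [map_add, map_one] at hχ
    by_cases hne : (WeakDual.CharacterSpace.toCLM χ).comp incl = 0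
    · have h : χ (incl f) = 0 := congrArg (fun T => T f) hne
      simp [h] at hχ
    · obtain ⟨l, hl⟩ := exists_eq_fourier ((WeakDual.CharacterSpace.toCLM χ).comp incl)
        (fun u v => (congrArg χ (incl_conv u v)).trans (map_mul χ _ _)) hne
      have h : χ (incl f) = fourier l f := congrArg (fun T => T f) hl
      exact hf l (h ▸ hχ)
  obtain ⟨v, hv⟩ := hunit.exists_right_inv
  let w : ConvAlgebra μ := (WithLp.ofLp v).snd
  let u : ConvAlgebra μ := f
  have hfst : ((1 : ℂ) + 0) * (WithLp.ofLp v).fst = 1 :=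
    congrArg (fun u => (WithLp.ofLp u).fst) hv
  have hsnd : ((1 : ℂ) + 0) • w + (WithLp.ofLp v).fst • ((0 : ConvAlgebra μ) + u) +
      ((0 : ConvAlgebra μ) + u) * w = 0 :=
    congrArg (fun u => (WithLp.ofLp u).snd) hv
  rw [add_zero, one_mul] at hfst
  rw [hfst, add_zero, one_smul, one_smul, zero_add] at hsnd
  refine ⟨-w, ?_⟩
  have h : u = -w + u * (-w) := by
    rw [mul_neg, ← sub_eq_zero, ← hsnd]
    abel
  exact h

end L1Convolution

open L1Convolution in
/-- **Wiener–Lévy theorem** for `z ↦ z / (1 + z)`. -/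
theorem exists_integrable_fourier_eq_div {k : V → ℂ} (hk : Integrable k μ)
    (hne : ∀ l : V →L[ℝ] ℝ, 1 + ∫ x, Complex.exp (l x * Complex.I) * k x ∂μ ≠ 0) :
    ∃ h : V → ℂ, Integrable h μ ∧ ∀ l : V →L[ℝ] ℝ,
      ∫ x, Complex.exp (l x * Complex.I) * h x ∂μ =
        (∫ x, Complex.exp (l x * Complex.I) * k x ∂μ) /
          (1 + ∫ x, Complex.exp (l x * Complex.I) * k x ∂μ) := by
  have hF : ∀ l : V →L[ℝ] ℝ,
      fourier l hk.toL1 = ∫ x, Complex.exp (l x * Complex.I) * k x ∂μ := by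
    intro l
    refine integral_congr_ae ?_
    filter_upwards [hk.coeFn_toL1] with x hx
    rw [hx]
  simp only [← hF] at hne ⊢
  obtain ⟨h, hh⟩ := exists_quasi_inverse hk.toL1 hne
  refine ⟨h, L1.integrable_coeFn h, fun l => ?_⟩
  rw [← L1Convolution.fourier_apply, eq_div_iff (hne l)]
  have := congrArg (fourier l) hh
  rw [map_add, fourier_conv] at this
  linear_combination -this

end Convolution

section HTransform

variable {n : ℕ}

/-- The linear form `x ↦ ∑ i, x i * y i`. -/
noncomputable def dotForm (y : Fin n → ℝ) : (Fin n → ℝ) →L[ℝ] ℝ :=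
  ∑ i, y i • ContinuousLinearMap.proj i

theorem dotForm_apply (x y : Fin n → ℝ) : dotForm y x = ∑ i, x i * y i := by
  simp [dotForm, mul_comm]

theorem exists_dotForm_eq (l : (Fin n → ℝ) →L[ℝ] ℝ) : ∃ y, dotForm y = l := by
  refine ⟨fun i => l (Pi.single i 1), ContinuousLinearMap.ext fun x => ?_⟩
  conv_rhs => rw [pi_eq_sum_univ' x]
  simp [dotForm_apply, map_sum]

theorem integrable_cos_mul {p : (Fin n → ℝ) → ℝ} (hp : Integrable p) (y : Fin n → ℝ) :
    Integrable fun x => cos (dotForm y x) * p x :=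
  hp.bdd_mul (c := 1) (by fun_prop) (Eventually.of_forall fun _ => abs_cos_le_one _)

theorem integrable_sin_mul {p : (Fin n → ℝ) → ℝ} (hp : Integrable p) (y : Fin n → ℝ) :
    Integrable fun x => sin (dotForm y x) * p x :=
  hp.bdd_mul (c := 1) (by fun_prop) (Eventually.of_forall fun _ => abs_sin_le_one _)

theorem Htransform_eq (a b : ℝ) {f : (Fin n → ℝ) → ℝ} (hf : Integrable f) (y : Fin n → ℝ) :
    Htransform n a b f y = (2 * π) ^ (-(n : ℝ) / 2) *
      (a * ∫ x, cos (dotForm y x) * f x) + (2 * π) ^ (-(n : ℝ) / 2) *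
        (b * ∫ x, sin (dotForm y x) * f x) := by
  rw [Htransform, ← mul_add, ← integral_const_mul a, ← integral_const_mul b,
    ← integral_add ((integrable_cos_mul hf y).const_mul a) ((integrable_sin_mul hf y).const_mul b)]
  simp only [dotForm_apply, add_mul, mul_assoc]

theorem integral_cos_mul_comp_neg (p : (Fin n → ℝ) → ℝ) (y : Fin n → ℝ) :
    ∫ x, cos (dotForm y x) * p (-x) = ∫ x, cos (dotForm y x) * p x := by
  rw [← integral_neg_eq_self]
  simp

theorem integral_sin_mul_comp_neg (p : (Fin n → ℝ) → ℝ) (y : Fin n → ℝ) :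
    ∫ x, sin (dotForm y x) * p (-x) = -∫ x, sin (dotForm y x) * p x := by
  rw [← integral_neg_eq_self, ← integral_neg]
  simp

theorem integral_exp_mul_ofReal {p : (Fin n → ℝ) → ℝ} (hp : Integrable p) (y : Fin n → ℝ) :
    ∫ x, Complex.exp (dotForm y x * Complex.I) * (p x : ℂ) =
      (∫ x, cos (dotForm y x) * p x : ℝ) + (∫ x, sin (dotForm y x) * p x : ℝ) * Complex.I := by
  rw [← integral_complex_ofReal, ← integral_complex_ofReal, ← integral_mul_const,
    ← integral_add (integrable_cos_mul hp y).ofReal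
      ((integrable_sin_mul hp y).ofReal.mul_const _)]
  refine integral_congr_ae (Eventually.of_forall fun x => ?_)
  simp only [Complex.exp_mul_I]
  push_cast
  ring

/-- The `ℋ`-transform of an integrable function is a Fourier transform. -/
theorem exists_integrable_fourier_eq_Htransform (a b : ℝ) {g : (Fin n → ℝ) → ℝ}
    (hg : Integrable g) : ∃ k : (Fin n → ℝ) → ℂ, Integrable k ∧ ∀ y,
      ∫ x, Complex.exp (dotForm y x * Complex.I) * k x = Htransform n a b g y := by
  set c : ℝ := (2 * π) ^ (-(n : ℝ) / 2) with hc
  have hgn : Integrable fun x => g (-x) := hg.comp_neg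
  have h₁ (y : Fin n → ℝ) : Integrable fun x =>
      Complex.exp (dotForm y x * Complex.I) * (g x : ℂ) :=
    hg.ofReal.bdd_mul (c := 1) (by fun_prop)
      (Eventually.of_forall fun _ => (Complex.norm_exp_ofReal_mul_I _).le)
  have h₂ (y : Fin n → ℝ) : Integrable fun x =>
      Complex.exp (dotForm y x * Complex.I) * (g (-x) : ℂ) :=
    hgn.ofReal.bdd_mul (c := 1) (by fun_prop)
      (Eventually.of_forall fun _ => (Complex.norm_exp_ofReal_mul_I _).le)
  refine ⟨fun x => (c * (a - b * Complex.I) / 2) * (g x : ℂ) +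
      (c * (a + b * Complex.I) / 2) * (g (-x) : ℂ),
    (hg.ofReal.const_mul _).add (hgn.ofReal.const_mul _), fun y => ?_⟩
  simp only [mul_add, mul_left_comm (Complex.exp _) (_ / _)]
  rw [integral_add ((h₁ y).const_mul _) ((h₂ y).const_mul _), integral_const_mul,
    integral_const_mul, integral_exp_mul_ofReal hg, integral_exp_mul_ofReal hgn,
    integral_cos_mul_comp_neg, integral_sin_mul_comp_neg, Htransform_eq a b hg, ← hc]
  push_cast
  linear_combination (-c * b * (∫ x, sin (dotForm y x) * g x : ℝ) : ℂ) * Complex.I_sq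

/-- A real-valued Fourier transform is the sum of a cosine and a sine transform. -/
theorem exists_integrable_cos_add_sin_eq {h : (Fin n → ℝ) → ℂ} (hh : Integrable h)
    {Φ : (Fin n → ℝ) → ℝ}
    (hΦ : ∀ y, ∫ x, Complex.exp (dotForm y x * Complex.I) * h x = Φ y) :
    ∃ p q : (Fin n → ℝ) → ℝ, Integrable p ∧ Integrable q ∧ ∀ y,
      Φ y = (∫ x, cos (dotForm y x) * p x) + ∫ x, sin (dotForm y x) * q x := by
  have hre : Integrable fun x => (h x).re := hh.re
  have him : Integrable fun x => -(h x).im := hh.im.neg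
  refine ⟨fun x => (h x).re, fun x => -(h x).im, hre, him, fun y => ?_⟩
  have h_int : Integrable fun x => Complex.exp (dotForm y x * Complex.I) * h x :=
    hh.bdd_mul (c := 1) (by fun_prop)
      (Eventually.of_forall fun _ => (Complex.norm_exp_ofReal_mul_I _).le)
  rw [← integral_add (integrable_cos_mul hre y) (integrable_sin_mul him y),
    ← Complex.ofReal_re (Φ y), ← hΦ y]
  refine (integral_re h_int).symm.trans ?_
  refine integral_congr_ae (Eventually.of_forall fun x => ?_)
  simp [Complex.exp_ofReal_mul_I_re, Complex.exp_ofReal_mul_I_im]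
  ring

/-- If the sine part vanishes when `b = 0`, a sum of a cosine and a sine transform is an
`ℋ`-transform. -/
theorem exists_integrable_Htransform_eq {a b : ℝ} (ha : a ≠ 0) {p q : (Fin n → ℝ) → ℝ}
    (hp : Integrable p) (hq : Integrable q)
    (hb : b = 0 → ∀ y, ∫ x, sin (dotForm y x) * q x = 0) :
    ∃ η : (Fin n → ℝ) → ℝ, Integrable η ∧ ∀ y, Htransform n a b η y =
      (∫ x, cos (dotForm y x) * p x) + ∫ x, sin (dotForm y x) * q x := by
  set c : ℝ := (2 * π) ^ (-(n : ℝ) / 2) with hc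
  have hc0 : c ≠ 0 := (by positivity : 0 < c).ne'
  set P : (Fin n → ℝ) → ℝ := fun x => (2 * c * a)⁻¹ * (p x + p (-x)) with hP
  set Q : (Fin n → ℝ) → ℝ := fun x => (2 * c * b)⁻¹ * (q x - q (-x)) with hQ
  have hPi : Integrable P := (hp.add hp.comp_neg).const_mul _
  have hQi : Integrable Q := (hq.sub hq.comp_neg).const_mul _
  have hPQ : Integrable (fun x => P x + Q x) := hPi.add hQi
  refine ⟨fun x => P x + Q x, hPQ, fun y => ?_⟩
  have hcosP : ∫ x, cos (dotForm y x) * P x =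
      (2 * c * a)⁻¹ * (2 * ∫ x, cos (dotForm y x) * p x) := by
    simp only [hP, mul_left_comm (cos _) (_⁻¹), mul_add (cos _)]
    rw [integral_const_mul, integral_add (integrable_cos_mul hp y)
      (integrable_cos_mul hp.comp_neg y), integral_cos_mul_comp_neg, ← two_mul]
  have hsinQ : ∫ x, sin (dotForm y x) * Q x =
      (2 * c * b)⁻¹ * (2 * ∫ x, sin (dotForm y x) * q x) := by
    simp only [hQ, mul_left_comm (sin _) (_⁻¹), mul_sub (sin _)]
    rw [integral_const_mul, integral_sub (integrable_sin_mul hq y)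
      (integrable_sin_mul hq.comp_neg y), integral_sin_mul_comp_neg, sub_neg_eq_add,
      ← two_mul]
  have hcosQ : ∫ x, cos (dotForm y x) * Q x = 0 := by
    simp only [hQ, mul_left_comm (cos _) (_⁻¹), mul_sub (cos _)]
    rw [integral_const_mul, integral_sub (integrable_cos_mul hq y)
      (integrable_cos_mul hq.comp_neg y), integral_cos_mul_comp_neg, sub_self, mul_zero]
  have hsinP : ∫ x, sin (dotForm y x) * P x = 0 := by
    simp only [hP, mul_left_comm (sin _) (_⁻¹), mul_add (sin _)]
    rw [integral_const_mul, integral_add (integrable_sin_mul hp y)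
      (integrable_sin_mul hp.comp_neg y), integral_sin_mul_comp_neg, add_neg_cancel, mul_zero]
  rw [Htransform_eq a b hPQ, ← hc]
  simp only [mul_add (cos _), mul_add (sin _)]
  rw [integral_add (integrable_cos_mul hPi y) (integrable_cos_mul hQi y),
    integral_add (integrable_sin_mul hPi y) (integrable_sin_mul hQi y),
    hcosP, hcosQ, hsinP, hsinQ]
  rcases eq_or_ne b 0 with rfl | hb0
  · rw [hb rfl y]
    field_simp
    ring
  · field_simp
    ring

end HTransform

theorem stmt11 (n : ℕ) (hn : 1 ≤ n) (a b : ℝ) (ha : a ≠ 0)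
    (hab : a ^ 2 + b ^ 2 ≠ 0) (hab1 : a ≠ b) (hab2 : a ≠ -b)
    (g : (Fin n → ℝ) → ℝ) (hg : Integrable g volume)
    (hnv : ∀ y, 1 + Htransform n a b g y ≠ 0) :
    ∃ η : (Fin n → ℝ) → ℝ, Integrable η volume ∧
      ∀ y, Htransform n a b η y =
        (Htransform n a b g y) / (1 + Htransform n a b g y) := by
  obtain ⟨k, hk, hkF⟩ := exists_integrable_fourier_eq_Htransform a b hg
  obtain ⟨h, hh, hhF⟩ := exists_integrable_fourier_eq_div hk fun l => by
    obtain ⟨y, rfl⟩ := exists_dotForm_eq l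
    rw [hkF]
    exact_mod_cast hnv y
  obtain ⟨p, q, hp, hq, hpq⟩ := exists_integrable_cos_add_sin_eq hh
    (Φ := fun y => Htransform n a b g y / (1 + Htransform n a b g y))
    (fun y => by rw [hhF, hkF]; push_cast; rfl)
  obtain ⟨η, hη, hηF⟩ := exists_integrable_Htransform_eq (b := b) ha hp hq (by
    rintro rfl y
    have hform : ∀ x, dotForm (-y) x = -dotForm y x := fun x => by simp [dotForm_apply]
    have heven : Htransform n a 0 g (-y) = Htransform n a 0 g y := by simp [Htransform]
    have h₁ := hpq y
    have h₂ := hpq (-y)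
    simp only [hform, cos_neg, sin_neg, neg_mul, integral_neg] at h₂
    simp only [heven] at h₂
    linarith)
  exact ⟨η, hη, fun y => (hηF y).trans (hpq y).symm⟩
end
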